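/- For all real constants ε > 0 and α > 0 there exist a constant δ > 0 and C > 0 such that for every n ≥ 1 and every integer m with α·n ≤ m ≤ 2n: if V is a uniformly random m-dimensional subspace of F₂^{2n}, then Pr[dim(V ∩ V^⊥) ≥ ε·n] ≤ C·2^{−δ·n²}. -/

import Mathlib

open scoped BigOperators Classical

/-- The symplectic inner product on `F₂^{2n}` (coordinates indexed by `Fin n ⊕ Fin n`). -/
def symp {n : ℕ} (u v : (Fin n ⊕ Fin n) → ZMod 2) : ZMod 2 :=
  ∑ i : Fin n, (u (Sum.inl i) * v (Sum.inr i) + u (Sum.inr i) * v (Sum.inl i))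

/-- The symplectic dual `V^⊥ = {w : symp w v = 0 for all v ∈ V}`, as a submodule. -/
def sympDualSub {n : ℕ} (V : Submodule (ZMod 2) ((Fin n ⊕ Fin n) → ZMod 2)) :
    Submodule (ZMod 2) ((Fin n ⊕ Fin n) → ZMod 2) where
  carrier := {w | ∀ v ∈ V, symp w v = 0}
  zero_mem' := by
    intro v hv
    simp [symp]
  add_mem' := by
    intro a b ha hb v hv
    have h : symp (a + b) v = symp a v + symp b v := by
      simp only [symp, Pi.add_apply, add_mul]
      rw [← Finset.sum_add_distrib]
      exact Finset.sum_congr rfl fun i _ => by ring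
    rw [h, ha v hv, hb v hv, add_zero]
  smul_mem' := by
    intro c x hx v hv
    have h : symp (c • x) v = c * symp x v := by
      simp only [symp, Pi.smul_apply, smul_eq_mul, Finset.mul_sum]
      exact Finset.sum_congr rfl fun i _ => by ring
    rw [h, hx v hv, mul_zero]


abbrev Vec (n : ℕ) := (Fin n ⊕ Fin n) → ZMod 2

lemma card_upper {E : Type*} [Fintype E] (P : ∀ k : ℕ, (Fin k → E) → Prop)
    (S : ∀ k : ℕ, (Fin k → E) → Finset E) (a : ℕ → ℕ) (m : ℕ)
    (hP : ∀ k < m, ∀ t : Fin (k+1) → E, P (k+1) t →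
      P k (Fin.init t) ∧ t (Fin.last k) ∈ S k (Fin.init t))
    (hS : ∀ k < m, ∀ s, P k s → (S k s).card ≤ 2 ^ a k) :
    (Finset.univ.filter (P m)).card ≤ 2 ^ (∑ k ∈ Finset.range m, a k) := by
  induction m with
  | zero =>
    simp only [Finset.range_zero, Finset.sum_empty, pow_zero]
    refine (Finset.card_le_univ _).trans ?_
    simp
  | succ m ih =>
    have ih' := ih (fun k hk => hP k (by omega)) (fun k hk => hS k (by omega))
    rw [Finset.sum_range_succ, pow_add, mul_comm]
    refine le_trans (Finset.card_le_mul_card_image_of_maps_to (f := Fin.init)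
      (t := Finset.univ.filter (P m)) ?_ (2 ^ a m) ?_) (Nat.mul_le_mul_left _ ih')
    · intro t ht
      simp only [Finset.mem_filter, Finset.mem_univ, true_and] at ht ⊢
      exact (hP m (by omega) t ht).1
    · intro s hs
      simp only [Finset.mem_filter, Finset.mem_univ, true_and] at hs
      refine le_trans ?_ (hS m (by omega) s hs)
      refine Finset.card_le_card_of_injOn (fun t => t (Fin.last m)) ?_ ?_
      · intro t ht
        simp only [Finset.coe_filter, Finset.mem_filter, Finset.mem_univ, true_and,
          Set.mem_ofPred_eq] at ht
        have := (hP m (by omega) t ht.1).2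
        rw [ht.2] at this
        exact this
      · intro t ht t' ht' h
        simp only [Finset.coe_filter, Finset.mem_filter, Finset.mem_univ, true_and,
          Set.mem_ofPred_eq] at ht ht'
        rw [← Fin.snoc_init_self t, ← Fin.snoc_init_self t', ht.2, ht'.2]
        simp only at h
        rw [h]

lemma card_lower {E : Type*} [Fintype E] (P : ∀ k : ℕ, (Fin k → E) → Prop)
    (S : ∀ k : ℕ, (Fin k → E) → Finset E) (a : ℕ → ℕ) (m : ℕ)
    (h0 : ∀ s, P 0 s)
    (hP : ∀ k < m, ∀ s : Fin k → E, P k s → ∀ x ∈ S k s,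
      P (k+1) (Fin.snoc s x : Fin (k+1) → E))
    (hS : ∀ k < m, ∀ s, P k s → 2 ^ a k ≤ (S k s).card) :
    2 ^ (∑ k ∈ Finset.range m, a k) ≤ (Finset.univ.filter (P m)).card := by
  induction m with
  | zero =>
    simp [h0]
  | succ m ih =>
    have ih' := ih (fun k hk => hP k (by omega)) (fun k hk => hS k (by omega))
    rw [Finset.sum_range_succ, pow_add, mul_comm]
    set Q := (Finset.univ.filter (P (m+1))).filter (fun t => P m (Fin.init t))
    refine le_trans (Nat.mul_le_mul_left _ ih') ?_
    refine le_trans (Finset.mul_card_image_le_card_of_maps_to (f := Fin.init) (s := Q)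
      (t := Finset.univ.filter (P m)) ?_ (2 ^ a m) ?_)
      (Finset.card_le_card (Finset.filter_subset _ _))
    · intro t ht
      simp only [Q, Finset.mem_filter, Finset.mem_univ, true_and] at ht ⊢
      exact ht.2
    · intro s hs
      simp only [Finset.mem_filter, Finset.mem_univ, true_and] at hs
      refine le_trans (hS m (by omega) s hs) ?_
      refine Finset.card_le_card_of_injOn (fun x => (Fin.snoc s x : Fin (m+1) → E)) ?_ ?_
      · intro x hx
        have := hP m (by omega) s hs x hx
        simp only [Q, Finset.coe_filter, Finset.mem_filter, Finset.mem_univ, true_and,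
          Set.mem_ofPred_eq, Fin.init_snoc, and_true]
        exact ⟨this, hs⟩
      · intro x _ y _ h
        have := congrFun h (Fin.last m)
        simpa using this

/-- The symplectic form as a bilinear form. -/
def sympB (n : ℕ) : LinearMap.BilinForm (ZMod 2) (Vec n) :=
  LinearMap.mk₂ (ZMod 2) symp
    (by
      intro a b v
      simp only [symp, Pi.add_apply, add_mul]
      rw [← Finset.sum_add_distrib]
      exact Finset.sum_congr rfl fun i _ => by ring)
    (by
      intro c x v
      simp only [symp, Pi.smul_apply, smul_eq_mul, Finset.mul_sum]
      exact Finset.sum_congr rfl fun i _ => by ring)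
    (by
      intro v a b
      simp only [symp, Pi.add_apply, mul_add]
      rw [← Finset.sum_add_distrib]
      exact Finset.sum_congr rfl fun i _ => by ring)
    (by
      intro c x v
      simp only [symp, Pi.smul_apply, smul_eq_mul, Finset.mul_sum]
      exact Finset.sum_congr rfl fun i _ => by ring)

lemma sympB_apply {n : ℕ} (u v : Vec n) : sympB n u v = symp u v := rfl

lemma symp_comm {n : ℕ} (u v : Vec n) : symp u v = symp v u := by
  unfold symp
  exact Finset.sum_congr rfl fun i _ => by ring

lemma sympB_nondeg (n : ℕ) : (sympB n).Nondegenerate := by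
  have hl : ∀ u : Vec n, (∀ v, symp u v = 0) → u = 0 := by
    intro u hu
    funext i
    rcases i with i | i
    · have := hu (Pi.single (Sum.inr i) 1)
      simpa [symp, Pi.single_apply] using this
    · have := hu (Pi.single (Sum.inl i) 1)
      simpa [symp, Pi.single_apply] using this
  refine ⟨fun u hu => hl u hu, fun u hu => hl u fun v => ?_⟩
  rw [symp_comm]; exact hu v

lemma card_sub {n : ℕ} (W : Submodule (ZMod 2) (Vec n)) :
    (Finset.univ.filter (fun x => x ∈ W)).card = 2 ^ Module.finrank (ZMod 2) W := by
  have h := Module.card_eq_pow_finrank (K := ZMod 2) (V := W)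
  rw [ZMod.card] at h
  rw [← h, Fintype.card_subtype]

lemma card_diff {n k d : ℕ} (W : Submodule (ZMod 2) (Vec n)) (s : Fin k → Vec n)
    (hd : d ≤ Module.finrank (ZMod 2) W) (hk : k < d) :
    2 ^ (d - 1) ≤ (Finset.univ.filter
      (fun x => x ∈ W ∧ x ∉ Submodule.span (ZMod 2) (Set.range s))).card := by
  set U := Submodule.span (ZMod 2) (Set.range s)
  have h1 := card_sub W
  have h2 := card_sub U
  have h3 : Module.finrank (ZMod 2) U ≤ k := by
    have := finrank_range_le_card (R := ZMod 2) s
    rw [Fintype.card_fin] at this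
    exact this
  have h4 : (Finset.univ.filter (fun x => x ∈ W)).card ≤
      (Finset.univ.filter (fun x => x ∈ W ∧ x ∉ U)).card
        + (Finset.univ.filter (fun x => x ∈ U)).card := by
    refine le_trans (Finset.card_le_card ?_) (Finset.card_union_le _ _)
    intro x hx
    simp only [Finset.mem_union, Finset.mem_filter, Finset.mem_univ, true_and] at hx ⊢
    tauto
  have h5 : 2 ^ Module.finrank (ZMod 2) U ≤ 2 ^ (d - 1) :=
    Nat.pow_le_pow_right (by norm_num) (by omega)
  have h6 : 2 ^ d ≤ 2 ^ Module.finrank (ZMod 2) W := Nat.pow_le_pow_right (by norm_num) hd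
  have h7 : 2 ^ d = 2 ^ (d - 1) + 2 ^ (d - 1) := by
    obtain ⟨e, rfl⟩ : ∃ e, d = e + 1 := ⟨d - 1, by omega⟩
    simp [pow_succ]; ring
  omega

/-- Independent tuples in `V` whose first `r` entries are in `R`. -/
def PV {n : ℕ} (r : ℕ) (V R : Submodule (ZMod 2) (Vec n)) (k : ℕ) (t : Fin k → Vec n) : Prop :=
  LinearIndependent (ZMod 2) t ∧ ∀ i : Fin k, t i ∈ V ∧ (i.val < r → t i ∈ R)

/-- Independent tuples whose first `r` entries are orthogonal to everything. -/
def PG {n : ℕ} (r : ℕ) (k : ℕ) (t : Fin k → Vec n) : Prop :=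
  LinearIndependent (ZMod 2) t ∧ ∀ i j : Fin k, i.val < r → symp (t i) (t j) = 0

lemma lower_PV {n m r : ℕ} (V R : Submodule (ZMod 2) (Vec n)) (hRV : R ≤ V)
    (hV : Module.finrank (ZMod 2) V = m) (hR : r ≤ Module.finrank (ZMod 2) R)
    {l : ℕ} (hl : l ≤ m) :
    2 ^ (∑ k ∈ Finset.range l, if k < r then r - 1 else m - 1) ≤
      (Finset.univ.filter (PV r V R l)).card := by
  refine card_lower (PV r V R) (fun k s => Finset.univ.filter
      (fun x => x ∈ (if k < r then R else V) ∧ x ∉ Submodule.span (ZMod 2) (Set.range s)))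
      _ l ?_ ?_ ?_
  · intro s
    exact ⟨linearIndependent_empty_type, fun i => i.elim0⟩
  · intro k hk s hs x hx
    simp only [Finset.mem_filter, Finset.mem_univ, true_and] at hx
    refine ⟨linearIndependent_finSnoc.2 ⟨hs.1, hx.2⟩, ?_⟩
    intro i
    refine Fin.lastCases ?_ (fun i => ?_) i
    · simp only [Fin.snoc_last, Fin.val_last]
      split_ifs at hx with h
      · exact ⟨hRV hx.1, fun _ => hx.1⟩
      · exact ⟨hx.1, fun h' => absurd h' h⟩
    · simpa using hs.2 i
  · intro k hk s hs
    by_cases h : k < r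
    · simp only [h, if_true]
      exact card_diff R s hR h
    · simp only [h, if_false]
      exact card_diff V s hV.ge (by omega)

lemma upper_PG {n m r : ℕ} :
    (Finset.univ.filter (PG (n := n) r m)).card ≤
      2 ^ (∑ k ∈ Finset.range m, (2 * n - min k r)) := by
  refine card_upper (PG (n := n) r) (fun k s => Finset.univ.filter
      (fun x => ∀ i : Fin k, i.val < r → symp (s i) x = 0)) _ m ?_ ?_
  · intro k hk t ht
    refine ⟨⟨?_, ?_⟩, ?_⟩
    · exact ht.1.comp _ (Fin.castSucc_injective k)
    · intro i j hi
      exact ht.2 i.castSucc j.castSucc hi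
    · simp only [Finset.mem_filter, Finset.mem_univ, true_and]
      intro i hi
      exact ht.2 i.castSucc (Fin.last k) hi
  · intro k hk s hs
    set f : Fin (min k r) → Vec n := fun i => s (Fin.castLE (min_le_left k r) i)
    have hf : LinearIndependent (ZMod 2) f := hs.1.comp _ (Fin.castLE_injective _)
    set W := Submodule.span (ZMod 2) (Set.range f)
    have hW : Module.finrank (ZMod 2) W = min k r := by
      simpa using finrank_span_eq_card hf
    have ho := LinearMap.BilinForm.finrank_orthogonal (sympB_nondeg n) W
    have hE : Module.finrank (ZMod 2) (Vec n) = 2 * n := by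
      simp [Vec]; ring
    rw [hE, hW] at ho
    rw [← ho, ← card_sub]
    refine Finset.card_le_card ?_
    intro x hx
    simp only [Finset.mem_filter, Finset.mem_univ, true_and] at hx ⊢
    rw [LinearMap.BilinForm.mem_orthogonal_iff]
    intro w hw
    change sympB n w x = 0
    induction hw using Submodule.span_induction with
    | mem y hy =>
      obtain ⟨i, rfl⟩ := hy
      exact hx _ (lt_of_lt_of_le i.2 (min_le_right _ _))
    | zero => simp
    | add a b _ _ ha hb => simp [ha, hb]
    | smul c a _ ha => simp [ha]

lemma span_eq_of_PV {n m r : ℕ} {V R : Submodule (ZMod 2) (Vec n)} {t : Fin m → Vec n}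
    (hV : Module.finrank (ZMod 2) V = m) (ht : PV r V R m t) :
    Submodule.span (ZMod 2) (Set.range t) = V := by
  refine Submodule.eq_of_le_of_finrank_eq ?_ ?_
  · rw [Submodule.span_le]
    rintro _ ⟨i, rfl⟩
    exact (ht.2 i).1
  · rw [finrank_span_eq_card ht.1, hV]; simp

lemma bad_count {n m r : ℕ} (B : Finset (Submodule (ZMod 2) (Vec n)))
    (hB : ∀ V ∈ B, Module.finrank (ZMod 2) V = m ∧
      r ≤ Module.finrank (ZMod 2) ↥(V ⊓ sympDualSub V)) :
    2 ^ (∑ k ∈ Finset.range m, if k < r then r - 1 else m - 1) * B.card ≤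
      2 ^ (∑ k ∈ Finset.range m, (2 * n - min k r)) := by
  refine le_trans ?_ (upper_PG (n := n) (m := m) (r := r))
  set Q := (Finset.univ.filter (PG (n := n) r m)).filter
    (fun t => Submodule.span (ZMod 2) (Set.range t) ∈ B)
  refine le_trans (Finset.mul_card_image_le_card_of_maps_to
    (f := fun t : Fin m → Vec n => Submodule.span (ZMod 2) (Set.range t)) (s := Q) (t := B)
    ?_ _ ?_) (Finset.card_le_card (Finset.filter_subset _ _))
  · intro t ht
    exact (Finset.mem_filter.1 ht).2
  · intro V hV
    obtain ⟨h1, h2⟩ := hB V hV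
    refine le_trans (lower_PV V (V ⊓ sympDualSub V) inf_le_left h1 h2 le_rfl) ?_
    refine Finset.card_le_card ?_
    intro t ht
    simp only [Finset.mem_filter, Finset.mem_univ, true_and, Q] at ht ⊢
    have hs := span_eq_of_PV h1 ht
    refine ⟨⟨⟨ht.1, ?_⟩, ?_⟩, hs⟩
    · intro i j hi
      exact ((ht.2 i).2 hi).2 _ (ht.2 j).1
    · rw [hs]; exact hV

lemma total_count {n m : ℕ} (hm : m ≤ 2 * n) :
    2 ^ (m * (2 * n - 1)) ≤ 2 ^ (m * m) * (Finset.univ.filter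
      (fun V : Submodule (ZMod 2) (Vec n) => Module.finrank (ZMod 2) V = m)).card := by
  have hE : Module.finrank (ZMod 2) (⊤ : Submodule (ZMod 2) (Vec n)) = 2 * n := by
    rw [finrank_top]; simp [Vec]; ring
  have h := lower_PV (r := 0) (⊤ : Submodule (ZMod 2) (Vec n)) ⊤ le_rfl hE (Nat.zero_le _) hm
  simp only [Nat.not_lt_zero, if_false, Finset.sum_const, Finset.card_range, smul_eq_mul] at h
  refine h.trans ?_
  refine Finset.card_le_mul_card_image_of_maps_to
    (f := fun t : Fin m → Vec n => Submodule.span (ZMod 2) (Set.range t)) ?_ _ ?_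
  · intro t ht
    simp only [Finset.mem_filter, Finset.mem_univ, true_and] at ht ⊢
    rw [finrank_span_eq_card ht.1]; simp
  · intro V hV
    simp only [Finset.mem_filter, Finset.mem_univ, true_and] at hV
    have hc := card_sub V
    rw [hV] at hc
    calc _ ≤ (Fintype.piFinset (fun _ : Fin m => Finset.univ.filter (fun x => x ∈ V))).card := by
          refine Finset.card_le_card ?_
          intro t ht
          simp only [Finset.mem_filter, Finset.mem_univ, true_and, Fintype.mem_piFinset] at ht ⊢
          intro i
          rw [← ht.2]
          exact Submodule.subset_span ⟨i, rfl⟩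
      _ = _ := by
          rw [Fintype.card_piFinset]
          simp only [hc, Finset.prod_const, Finset.card_univ, Fintype.card_fin]
          rw [← pow_mul]

lemma sumA {n r : ℕ} (q : ℕ) (h : r + q ≤ 2 * n) :
    ((∑ k ∈ Finset.range (r + q), (2 * n - min k r) : ℕ) : ℝ) =
      2 * n * (r + q) - r * (r - 1) / 2 - r * q := by
  have h0 : ∀ l ≤ r, ((∑ k ∈ Finset.range l, (2 * n - min k r) : ℕ) : ℝ) =
      2 * n * l - l * (l - 1) / 2 := by
    intro l hl
    induction l with
    | zero => simp
    | succ l ih =>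
      rw [Finset.sum_range_succ, Nat.cast_add, ih (by omega), min_eq_left (by omega),
        Nat.cast_sub (by omega)]
      push_cast; ring
  induction q with
  | zero => simpa using h0 r le_rfl
  | succ q ih =>
    rw [← add_assoc, Finset.sum_range_succ, Nat.cast_add, ih (by omega), min_eq_right (by omega),
        Nat.cast_sub (by omega)]
    push_cast; ring

lemma sumB {m r : ℕ} (hm : 1 ≤ m) (hr : 1 ≤ r) (q : ℕ) :
    ((∑ k ∈ Finset.range (r + q), (if k < r then r - 1 else m - 1) : ℕ) : ℝ) =
      r * (r - 1) + q * (m - 1) := by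
  induction q with
  | zero =>
    rw [add_zero, Finset.sum_congr rfl
      (fun k hk => if_pos (Finset.mem_range.1 hk))]
    simp [Nat.cast_sub hr]
  | succ q ih =>
    rw [← add_assoc, Finset.sum_range_succ, Nat.cast_add, ih, if_neg (by omega),
      Nat.cast_sub hm]
    push_cast; ring

/-- For all `ε, α > 0` there are `δ, C > 0` such that for all `n ≥ 1` and
`α·n ≤ m ≤ 2n`: a uniformly random `m`-dimensional subspace `V` of `F₂^{2n}` satisfies
`Pr[dim(rad V) ≥ ε·n] ≤ C·2^{-δ·n²}`, where `rad V = V ∩ V^⊥`. -/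
theorem stmt9 (ε α : ℝ) (hε : 0 < ε) (hα : 0 < α) :
    ∃ δ C : ℝ, 0 < δ ∧ 0 < C ∧
      ∀ n : ℕ, 1 ≤ n → ∀ m : ℕ, α * n ≤ (m : ℝ) → m ≤ 2 * n →
        (Nat.card {V : Submodule (ZMod 2) ((Fin n ⊕ Fin n) → ZMod 2) //
            Module.finrank (ZMod 2) V = m ∧
            ε * n ≤ (Module.finrank (ZMod 2) ↥(V ⊓ sympDualSub V) : ℝ)} : ℝ)
          ≤ C * (2 : ℝ) ^ (-(δ * (n : ℝ) ^ 2)) *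
            (Nat.card {V : Submodule (ZMod 2) ((Fin n ⊕ Fin n) → ZMod 2) //
              Module.finrank (ZMod 2) V = m} : ℝ) := by
  refine ⟨ε ^ 2 / 4, 2 ^ (25 / ε ^ 2), by positivity, by positivity, ?_⟩
  intro n hn m _ hm
  have hn' : (1 : ℝ) ≤ n := by exact_mod_cast hn
  set r := ⌈ε * n⌉₊ with hr
  have hr1 : 1 ≤ r := Nat.one_le_ceil_iff.2 (by positivity)
  have hrε : ε * n ≤ r := Nat.le_ceil _
  rw [Nat.card_eq_fintype_card, Nat.card_eq_fintype_card, Fintype.card_subtype,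
    Fintype.card_subtype]
  set B := Finset.univ.filter (fun V : Submodule (ZMod 2) (Vec n) =>
    Module.finrank (ZMod 2) V = m ∧
      ε * n ≤ (Module.finrank (ZMod 2) ↥(V ⊓ sympDualSub V) : ℝ)) with hBdef
  set T := (Finset.univ.filter (fun V : Submodule (ZMod 2) (Vec n) =>
    Module.finrank (ZMod 2) V = m)).card with hT
  rcases Finset.eq_empty_or_nonempty B with h0 | ⟨V₀, hV₀⟩
  · rw [h0]; simp only [Finset.card_empty, Nat.cast_zero]; positivity
  have hB : ∀ V ∈ B, Module.finrank (ZMod 2) V = m ∧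
      r ≤ Module.finrank (ZMod 2) ↥(V ⊓ sympDualSub V) := by
    intro V hV
    have := (Finset.mem_filter.1 hV).2
    exact ⟨this.1, Nat.ceil_le.2 this.2⟩
  have hrm : r ≤ m := by
    obtain ⟨h1, h2⟩ := hB V₀ hV₀
    rw [← h1]
    exact h2.trans (Submodule.finrank_mono inf_le_left)
  have hb := bad_count B hB
  have ht := total_count (n := n) hm
  rw [← hT] at ht
  obtain ⟨q, rfl⟩ := Nat.exists_eq_add_of_le hrm
  have sA := sumA q hm
  have sB := sumB (m := r + q) (by omega) hr1 q
  have hb' := (Nat.cast_le (α := ℝ)).2 hb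
  have ht' := (Nat.cast_le (α := ℝ)).2 ht
  rw [Nat.cast_mul, Nat.cast_pow, Nat.cast_pow, Nat.cast_ofNat, ← Real.rpow_natCast,
    ← Real.rpow_natCast, sA, sB] at hb'
  rw [Nat.cast_mul, Nat.cast_pow, Nat.cast_pow, Nat.cast_ofNat, ← Real.rpow_natCast,
    ← Real.rpow_natCast, Nat.cast_mul, Nat.cast_mul, Nat.cast_sub (by omega)] at ht'
  push_cast at hb' ht'
  have hmR : (r : ℝ) + q ≤ 2 * n := by exact_mod_cast hm
  have hq0 : (0 : ℝ) ≤ q := Nat.cast_nonneg q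
  set bb : ℝ := (r : ℝ) * (r - 1) + q * (r + q - 1) with hbb
  set aa : ℝ := 2 * n * (r + q) - r * (r - 1) / 2 - (r : ℝ) * q with haa
  set cc : ℝ := ((r : ℝ) + q) * (2 * n - 1) with hcc
  set dd : ℝ := ((r : ℝ) + q) * (r + q) with hdd
  have h1 : (B.card : ℝ) ≤ 2 ^ (aa - bb) := by
    rw [Real.rpow_sub (by norm_num), le_div_iff₀ (by positivity), mul_comm]
    exact hb'
  have h2 : (2 : ℝ) ^ (cc - dd) ≤ T := by
    rw [Real.rpow_sub (by norm_num), div_le_iff₀ (by positivity), mul_comm]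
    exact ht'
  have key : aa - bb ≤ 25 / ε ^ 2 + -(ε ^ 2 / 4 * n ^ 2) + (cc - dd) := by
    have e1 : aa - bb - (cc - dd) = -(r : ℝ) ^ 2 / 2 + r / 2 + 2 * (r + q) := by
      rw [haa, hbb, hcc, hdd]; ring
    have e2 : (ε * n) ^ 2 ≤ (r : ℝ) ^ 2 := by
      apply pow_le_pow_left₀ (by positivity) hrε
    have e3 : 0 ≤ (ε * n / 2 - 5 / ε) ^ 2 := sq_nonneg _
    have e4 : (ε * n / 2 - 5 / ε) ^ 2 = ε ^ 2 / 4 * n ^ 2 - 5 * n + 25 / ε ^ 2 := by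
      field_simp; ring
    rw [e4] at e3
    rw [mul_pow] at e2
    linarith
  calc (B.card : ℝ) ≤ 2 ^ (aa - bb) := h1
    _ ≤ 2 ^ (25 / ε ^ 2 + -(ε ^ 2 / 4 * n ^ 2) + (cc - dd)) :=
        Real.rpow_le_rpow_of_exponent_le (by norm_num) key
    _ = 2 ^ (25 / ε ^ 2) * 2 ^ (-(ε ^ 2 / 4 * (n : ℝ) ^ 2)) * 2 ^ (cc - dd) := by
        rw [Real.rpow_add (by norm_num), Real.rpow_add (by norm_num)]
    _ ≤ _ := mul_le_mul_of_nonneg_left h2 (by positivity)
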